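/- arXiv:2102.12543 — 2 statements merged into one kernel-verified Lean document; each statement's English description precedes it below -/
import Mathlib

section
/- Anti-guessing facets (Proposition, Appendix C.4): Let n', d, ε, m' be integers with n' = ε + m', n' − 2 ≥ d ≥ 2, and n' − d + 1 ≥ ε ≥ 3. Let G_A^{ε,m'} be the n'×n' block-diagonal matrix whose upper-left ε×ε block has 0 on the diagonal and 1 in every off-diagonal entry, whose lower-right m'×m' block is the identity I_{m'}, and which is 0 elsewhere. Then every P ∈ C_d^{n'→n'} satisfies ⟨G_A^{ε,m'}, P⟩ ≤ ε + d − 2, and (G_A^{ε,m'}, ε + d − 2) is a tight Bell inequality (facet) of C_d^{n'→n'}. -/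
open Finset

/-- A classical channel: an `n' × n` column-stochastic real matrix. -/
def IsChannel {n n' : ℕ} (P : Matrix (Fin n') (Fin n) ℝ) : Prop :=
  (∀ y x, 0 ≤ P y x) ∧ ∀ x, ∑ y, P y x = 1

/-- A vertex of the signaling polytope: a column-stochastic 0/1 matrix with
at most `d` nonzero rows. -/
def IsVertex {n n' : ℕ} (d : ℕ) (V : Matrix (Fin n') (Fin n) ℝ) : Prop :=
  IsChannel V ∧ (∀ y x, V y x = 0 ∨ V y x = 1) ∧
    ({y : Fin n' | ∃ x, V y x ≠ 0}).ncard ≤ d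

/-- The signaling polytope `C_d^{n → n'}`. -/
def signalingPolytope (n n' d : ℕ) : Set (Matrix (Fin n') (Fin n) ℝ) :=
  convexHull ℝ {V | IsVertex d V}

/-- The Euclidean inner product `⟨G, P⟩ = ∑_{x,y} G_{y,x} P(y|x)`. -/
def bip {n n' : ℕ} (G P : Matrix (Fin n') (Fin n) ℝ) : ℝ :=
  ∑ x, ∑ y, G y x * P y x

/-- `(G, γ)` is a tight Bell inequality (facet) of `C_d^{n → n'}`: it is valid on the
signaling polytope and is saturated by `n (n' - 1)` affinely independent vertices. -/
def IsTightBell (n n' d : ℕ) (G : Matrix (Fin n') (Fin n) ℝ) (γ : ℝ) : Prop :=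
  (∀ P ∈ signalingPolytope n n' d, bip G P ≤ γ) ∧
  ∃ V : Fin (n * (n' - 1)) → Matrix (Fin n') (Fin n) ℝ,
    AffineIndependent ℝ V ∧ ∀ i, IsVertex d (V i) ∧ bip G (V i) = γ

/-- The anti-guessing facet matrix `G_A^{ε,m'}` on `n' = ε + m'` outputs: the
upper-left `ε × ε` block has `0` on the diagonal and `1` off the diagonal, the
lower-right `m' × m'` block is the identity, and all other entries are `0`. -/
def antiGuessingMatrix (n' ε : ℕ) : Matrix (Fin n') (Fin n') ℝ :=
  Matrix.of fun y x =>
    if (y : ℕ) < ε ∧ (x : ℕ) < ε then (if y = x then 0 else 1)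
    else if ε ≤ (y : ℕ) ∧ y = x then 1 else 0

section Score

variable {α : Type*} [Fintype α] [DecidableEq α]

/-- The number of inputs on which the map `f` wins the anti-guessing game with block `L`:
on `L` it must answer within `L` without guessing the input, off `L` it must guess the input. -/
def antiGuessingScore (L : Finset α) (f : α → α) : ℕ :=
  #{x | (x ∈ L ∧ f x ∈ L ∧ f x ≠ x) ∨ (x ∉ L ∧ f x = x)}

/-- Maps with at most `d` values that attain the maximal score `#L + d - 2`. -/
def IsSaturating (L : Finset α) (d : ℕ) (f : α → α) : Prop :=
  #(univ.image f) ≤ d ∧ antiGuessingScore L f + 2 = #L + d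

theorem antiGuessingScore_add_two_le {L : Finset α} {d : ℕ} (hL : 2 ≤ #L) {f : α → α}
    (hf : #(univ.image f) ≤ d) : antiGuessingScore L f + 2 ≤ #L + d := by
  set R := univ.image f with hR
  have hfR (x : α) : f x ∈ R := mem_image_of_mem f (mem_univ x)
  have hsplit : #(R ∩ L) + #(R \ L) = #R := card_inter_add_card_sdiff R L
  have hscore : antiGuessingScore L f ≤ #{x ∈ L | f x ∈ L ∧ f x ≠ x} + #(R \ L) := by
    refine (card_le_card fun x hx => ?_).trans (card_union_le _ _)
    have := hfR x
    simp only [mem_filter, mem_univ, true_and] at hx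
    simp only [mem_union, mem_filter, mem_sdiff]
    grind
  rcases Nat.lt_or_ge (#(R ∩ L)) 2 with h | h
  · interval_cases h' : #(R ∩ L)
    · have : #{x ∈ L | f x ∈ L ∧ f x ≠ x} = 0 := by
        rw [card_eq_zero] at h' ⊢
        refine filter_eq_empty_iff.2 fun x _ hx => ?_
        exact notMem_empty (f x) (h' ▸ mem_inter.2 ⟨hfR x, hx.1⟩)
      omega
    · obtain ⟨a, ha⟩ := card_eq_one.1 h'
      have haL : a ∈ L := (mem_inter.1 (ha ▸ mem_singleton_self a : a ∈ R ∩ L)).2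
      have : #{x ∈ L | f x ∈ L ∧ f x ≠ x} ≤ #(L.erase a) := by
        refine card_le_card fun x hx => ?_
        obtain ⟨hx, hfx, hne⟩ := mem_filter.1 hx
        have : f x = a := mem_singleton.1 (ha ▸ mem_inter.2 ⟨hfR x, hfx⟩)
        exact mem_erase.2 ⟨fun h => hne (this.trans h.symm), hx⟩
      rw [card_erase_of_mem haL] at this
      omega
  · have : #{x ∈ L | f x ∈ L ∧ f x ≠ x} ≤ #L := card_filter_le _ _
    omega

theorem isSaturating_of_one_value {L S : Finset α} {d : ℕ} {a : α} {f : α → α} (ha : a ∈ L)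
    (hS : ∀ s ∈ S, s ∉ L) (hcard : #S + 1 = d) (hL : ∀ x ∈ L, x ≠ a → f x = a)
    (hfix : ∀ x ∈ S, f x = x) (hmem : ∀ x, f x = a ∨ f x ∈ S) : IsSaturating L d f := by
  constructor
  · rw [← hcard]
    refine (card_le_card (t := insert a S) ?_).trans (card_insert_le _ _)
    exact image_subset_iff.2 fun x _ => mem_insert.2 (hmem x)
  · have : antiGuessingScore L f = #(L.erase a ∪ S) := by
      unfold antiGuessingScore
      congr 1
      ext x
      have := hL x
      have := hfix x
      have := hmem x
      have := hS x
      have := hS (f x)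
      simp only [mem_filter, mem_univ, true_and, mem_union, mem_erase]
      grind
    rw [this, card_union_of_disjoint, card_erase_of_mem ha]
    · have := card_pos.2 ⟨a, ha⟩
      omega
    · exact disjoint_right.2 fun s hs h => hS s hs (mem_of_mem_erase h)

theorem isSaturating_of_two_values {L T : Finset α} {d : ℕ} {a b : α} {f : α → α} (ha : a ∈ L)
    (hb : b ∈ L) (hT : ∀ t ∈ T, t ∉ L) (hcard : #T + 2 = d)
    (hL : ∀ x ∈ L, f x ≠ x ∧ (f x = a ∨ f x = b)) (hfix : ∀ x ∈ T, f x = x)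
    (hmem : ∀ x, f x = a ∨ f x = b ∨ f x ∈ T) : IsSaturating L d f := by
  constructor
  · rw [← hcard]
    refine (card_le_card (t := insert a (insert b T)) ?_).trans ?_
    · refine image_subset_iff.2 fun x _ => ?_
      simpa only [mem_insert] using hmem x
    · have := card_insert_le a (insert b T)
      have := card_insert_le b T
      omega
  · have : antiGuessingScore L f = #(L ∪ T) := by
      unfold antiGuessingScore
      congr 1
      ext x
      have := hL x
      have := hfix x
      have := hmem x
      have := hT x
      have := hT (f x)
      simp only [mem_filter, mem_univ, true_and, mem_union]
      grind
    rw [this, card_union_of_disjoint]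
    · omega
    · exact disjoint_right.2 hT

theorem sum_update_apply (H : α → α → ℝ) (f : α → α) (x y : α) :
    ∑ z, H (Function.update f x y z) z = ∑ z, H (f z) z - H (f x) x + H y x := by
  rw [← add_sum_erase _ _ (mem_univ x), ← add_sum_erase _ (fun z => H (f z) z) (mem_univ x),
    Function.update_self, sum_congr rfl fun z hz => by
      rw [Function.update_of_ne (ne_of_mem_erase hz)]]
  ring

theorem isSaturating_ite {L S : Finset α} {d : ℕ} {a : α} (ha : a ∈ L) (hS : ∀ s ∈ S, s ∉ L)
    (hcard : #S + 1 = d) : IsSaturating L d (fun z => if z ∈ S then z else a) :=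
  isSaturating_of_one_value ha hS hcard (by grind) (by grind) (by grind)

theorem isSaturating_update_ite {L S : Finset α} {d : ℕ} {a x y : α} (ha : a ∈ L)
    (hS : ∀ s ∈ S, s ∉ L) (hcard : #S + 1 = d) (hx : x ∈ L → x = a) (hxS : x ∉ S) (hy : y ∈ S) :
    IsSaturating L d (Function.update (fun z => if z ∈ S then z else a) x y) :=
  isSaturating_of_one_value ha hS hcard (by grind) (by grind) (by grind)

theorem isSaturating_ite_ite {L T : Finset α} {d : ℕ} {a b : α} (ha : a ∈ L) (hb : b ∈ L)
    (hab : a ≠ b) (hT : ∀ t ∈ T, t ∉ L) (hcard : #T + 2 = d) :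
    IsSaturating L d (fun z => if z ∈ T then z else if z = a then b else a) :=
  isSaturating_of_two_values ha hb hT hcard (by grind) (by grind) (by grind)

theorem isSaturating_update_ite_ite {L T : Finset α} {d : ℕ} {a b x y : α} (ha : a ∈ L)
    (hb : b ∈ L) (hab : a ≠ b) (hT : ∀ t ∈ T, t ∉ L) (hcard : #T + 2 = d) (hx : x ∉ L)
    (hxT : x ∉ T) (hy : y = b ∨ y ∈ T) : IsSaturating L d
      (Function.update (fun z => if z ∈ T then z else if z = a then b else a) x y) :=
  isSaturating_of_two_values ha hb hT hcard (by grind) (by grind) (by grind)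

/-- A weight vanishing on all saturating maps, and at one losing answer for each input, is zero. -/
theorem eq_zero_of_forall_isSaturating {L : Finset α} {d : ℕ} (hL : 3 ≤ #L) (hd : 2 ≤ d)
    (hdL : d ≤ #Lᶜ + 1) {H : α → α → ℝ} {o : α} (ho : o ∈ L)
    (hH : ∀ f, IsSaturating L d f → ∑ x, H (f x) x = 0) (hdiag : ∀ x ∈ L, H x x = 0)
    (hout : ∀ x ∉ L, H o x = 0) (y x : α) : H y x = 0 := by
  have hupd {f : α → α} {x y : α} (hf : IsSaturating L d f)
      (hf' : IsSaturating L d (Function.update f x y)) : H (f x) x = H y x := by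
    have := sum_update_apply H f x y
    rw [hH f hf, hH _ hf'] at this
    linarith
  have hone {S : Finset α} {a x y : α} (ha : a ∈ L) (hS : ∀ s ∈ S, s ∉ L) (hc : #S + 1 = d)
      (hx : x ∈ L → x = a) (hxS : x ∉ S) (hy : y ∈ S) : H a x = H y x := by
    simpa [hxS] using hupd (isSaturating_ite ha hS hc) (isSaturating_update_ite ha hS hc hx hxS hy)
  have htwo {T : Finset α} {a b x y : α} (ha : a ∈ L) (hb : b ∈ L) (hab : a ≠ b)
      (hT : ∀ t ∈ T, t ∉ L) (hc : #T + 2 = d) (hx : x ∉ L) (hxT : x ∉ T) (hy : y = b ∨ y ∈ T) :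
      H a x = H y x := by
    have hxa : x ≠ a := fun h => hx (h ▸ ha)
    simpa [hxT, hxa] using hupd (isSaturating_ite_ite ha hb hab hT hc)
      (isSaturating_update_ite_ite ha hb hab hT hc hx hxT hy)
  obtain ⟨o', ho', hoo'⟩ : ∃ b ∈ L, b ≠ o := exists_mem_ne (by omega) o
  have houtin {a s : α} (ha : a ∈ L) (hs : s ∉ L) : H s a = 0 := by
    obtain ⟨S, hsS, hSL, hS⟩ := exists_subsuperset_card_eq (s := {s}) (t := Lᶜ) (n := d - 1)
      (by simpa using hs) (by rw [card_singleton]; omega) (by omega)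
    have hS' (z) (hz : z ∈ S) : z ∉ L := mem_compl.1 (hSL hz)
    rw [← hone ha hS' (by omega) (fun _ => rfl) (fun h => hS' a h ha)
      (singleton_subset_iff.1 hsS), hdiag a ha]
  have hset {x : α} (hx : x ∉ L) : d - 2 ≤ #(Lᶜ.erase x) := by
    rw [card_erase_of_mem (mem_compl.2 hx)]
    omega
  have hsub {x z : α} {T : Finset α} (hT : T ⊆ Lᶜ.erase x) (hz : z ∈ T) : z ∉ L :=
    mem_compl.1 (mem_of_mem_erase (hT hz))
  have hnotMem {x : α} {T : Finset α} (hT : T ⊆ Lᶜ.erase x) : x ∉ T :=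
    fun h => notMem_erase x _ (hT h)
  have hinout {a x : α} (ha : a ∈ L) (hx : x ∉ L) : H a x = 0 := by
    by_cases hao : a = o
    · rw [hao, hout x hx]
    obtain ⟨T, hTL, hT⟩ := exists_subset_card_eq (hset hx)
    rw [← htwo ho ha (Ne.symm hao) (fun _ => hsub hTL) (by omega) hx (hnotMem hTL) (Or.inl rfl),
      hout x hx]
  have houtout {t x : α} (ht : t ∉ L) (hx : x ∉ L) (htx : t ≠ x) : H t x = 0 := by
    rcases hd.eq_or_lt with rfl | hd3
    · rw [← hone (S := {t}) ho (by simpa using ht) (by rw [card_singleton])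
        (fun h => absurd h hx) (by simpa using htx.symm) (mem_singleton_self t), hout x hx]
    · obtain ⟨T, htT, hTL, hT⟩ := exists_subsuperset_card_eq (s := {t}) (t := Lᶜ.erase x)
        (n := d - 2) (by simpa using ⟨htx, ht⟩) (by rw [card_singleton]; omega) (hset hx)
      rw [← htwo ho ho' hoo'.symm (fun _ => hsub hTL) (by omega) hx (hnotMem hTL)
        (Or.inr (singleton_subset_iff.1 htT)), hout x hx]
  have hexch {a b s : α} (ha : a ∈ L) (hb : b ∈ L) (hba : b ≠ a) (hs : s ∉ L) :
      H b a = H s s := by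
    obtain ⟨T, hTL, hT⟩ := exists_subset_card_eq (hset hs)
    have hsT : s ∉ T := hnotMem hTL
    have hS' (z) (hz : z ∈ insert s T) : z ∉ L :=
      (mem_insert.1 hz).elim (fun h => h ▸ hs) (hsub hTL)
    have hone' := isSaturating_ite (d := d) ha hS' (by rw [card_insert_of_notMem hsT]; omega)
    have htwo' := isSaturating_ite_ite (d := d) (T := T) ha hb hba.symm (fun _ => hsub hTL) (by omega)
    have has : a ≠ s := fun h => hs (h ▸ ha)
    have haT : a ∉ T := fun h => hsub hTL h ha
    set f : α → α := fun z => if z ∈ insert s T then z else a with hf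
    have hfa : f a = a := by simp [hf]
    have hfs : Function.update f a b s = s := by
      rw [Function.update_of_ne has.symm]
      simp [hf]
    have heq : (fun z => if z ∈ T then z else if z = a then b else a) =
        Function.update (Function.update f a b) s a := by
      ext z
      simp only [Function.update_apply, hf, mem_insert]
      clear hH hupd hone htwo
      grind
    rw [heq] at htwo'
    have h := hH _ htwo'
    rw [sum_update_apply, sum_update_apply, hH _ hone', hfa, hfs, hdiag a ha,
      hinout ha hs] at h
    linarith
  obtain ⟨s, hs⟩ : (Lᶜ).Nonempty := card_pos.1 (by omega)
  rw [mem_compl] at hs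
  have hform (y x : α) : H y x =
      if (x ∈ L ∧ y ∈ L ∧ y ≠ x) ∨ (x ∉ L ∧ y = x) then H s s else 0 := by
    have hss (t : α) (ht : t ∉ L) : H t t = H s s := by
      rw [← hexch ho ho' hoo' ht, hexch ho ho' hoo' hs]
    by_cases hx : x ∈ L <;> by_cases hy : y ∈ L
    · by_cases hyx : y = x
      · subst hyx
        simp [hy, hdiag y hy]
      · simp [hx, hy, hyx, hexch hx hy hyx hs]
    · simp [hx, hy, houtin hx hy]
    · have : y ≠ x := fun h => hx (h ▸ hy)
      simp [hx, this, hinout hy hx]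
    · by_cases hyx : y = x
      · subst hyx
        simp [hy, hss y hy]
      · simp [hx, hyx, houtout hy hx hyx]
  obtain ⟨S, hSL, hS⟩ := exists_subset_card_eq (s := Lᶜ) (n := d - 1) (by omega)
  have hsat := isSaturating_ite ho (fun z hz => mem_compl.1 (hSL hz)) (by omega : #S + 1 = d)
  have hsum := hH _ hsat
  rw [sum_congr rfl fun z _ => hform _ z, ← sum_filter, sum_const, nsmul_eq_mul] at hsum
  have hss : H s s = 0 := by
    refine (mul_eq_zero.1 hsum).resolve_left (Nat.cast_ne_zero.2 fun hzero => ?_)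
    have hscore : antiGuessingScore L (fun z => if z ∈ S then z else o) = 0 := by
      rw [← hzero, antiGuessingScore]
    have := hsat.2
    omega
  rw [hform, hss, ite_self]

end Score

section Channel

variable {n n' : ℕ}

/-- The channel that deterministically answers `f x` on input `x`. -/
def deterministicChannel (f : Fin n → Fin n') : Matrix (Fin n') (Fin n) ℝ :=
  Matrix.of fun y x => if y = f x then 1 else 0

theorem bip_deterministicChannel (G : Matrix (Fin n') (Fin n) ℝ) (f : Fin n → Fin n') :
    bip G (deterministicChannel f) = ∑ x, G (f x) x := by
  simp [bip, deterministicChannel]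

theorem range_deterministicChannel (f : Fin n → Fin n') :
    {y : Fin n' | ∃ x, deterministicChannel f y x ≠ 0} = (univ.image f : Finset (Fin n')) := by
  ext y
  simp [deterministicChannel, eq_comm]

theorem isVertex_deterministicChannel {d : ℕ} {f : Fin n → Fin n'} (hf : #(univ.image f) ≤ d) :
    IsVertex d (deterministicChannel f) := by
  refine ⟨⟨fun y x => ?_, fun x => ?_⟩, fun y x => ?_, ?_⟩
  · simp only [deterministicChannel, Matrix.of_apply]
    positivity
  · simp [deterministicChannel]
  · simp only [deterministicChannel, Matrix.of_apply]
    split_ifs <;> simp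
  · rwa [range_deterministicChannel, Set.ncard_coe_finset]

theorem IsVertex.exists_eq_deterministicChannel {d : ℕ} {V : Matrix (Fin n') (Fin n) ℝ}
    (hV : IsVertex d V) : ∃ f : Fin n → Fin n', #(univ.image f) ≤ d ∧
      V = deterministicChannel f := by
  obtain ⟨⟨hnonneg, hsum⟩, h01, hcard⟩ := hV
  have hex (x : Fin n) : ∃ y, V y x = 1 := by
    by_contra! h
    have := hsum x
    rw [sum_eq_zero fun y _ => (h01 y x).resolve_right (h y)] at this
    exact zero_ne_one this
  choose f hf using hex
  have hVf : V = deterministicChannel f := by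
    ext y x
    simp only [deterministicChannel, Matrix.of_apply]
    split_ifs with h
    · rw [h, hf]
    · refine (h01 y x).resolve_right fun hy => ?_
      have := sum_le_sum_of_subset_of_nonneg (subset_univ {y, f x})
        fun z _ _ => hnonneg z x
      rw [hsum, sum_pair h, hy, hf] at this
      norm_num at this
  refine ⟨f, ?_, hVf⟩
  rwa [hVf, range_deterministicChannel, Set.ncard_coe_finset] at hcard

theorem bip_le_of_forall_isVertex {d : ℕ} {G : Matrix (Fin n') (Fin n) ℝ} {γ : ℝ}
    (h : ∀ V, IsVertex d V → bip G V ≤ γ) {P : Matrix (Fin n') (Fin n) ℝ}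
    (hP : P ∈ signalingPolytope n n' d) : bip G P ≤ γ := by
  have hlin : IsLinearMap ℝ (bip G) :=
    { map_add := fun P Q => by simp [bip, mul_add, sum_add_distrib]
      map_smul := fun c P => by simp [bip, mul_sum, mul_left_comm] }
  exact convexHull_min (t := {P | bip G P ≤ γ}) h (convex_halfSpace_le hlin γ) hP

/-- If deterministic channels from a family, together with one matrix unit per column, span all
matrices, then the family contains `n * (n' - 1)` affinely independent channels. -/
theorem exists_affineIndependent_deterministicChannel {p : (Fin n → Fin n') → Prop}
    (c : Fin n → Fin n')
    (h : ∀ H : Fin n' → Fin n → ℝ, (∀ f, p f → ∑ x, H (f x) x = 0) → (∀ x, H (c x) x = 0) →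
      ∀ y x, H y x = 0) :
    ∃ f : Fin (n * (n' - 1)) → Fin n → Fin n',
      AffineIndependent ℝ (fun i => deterministicChannel (f i)) ∧ ∀ i, p (f i) := by
  set s : Set (Matrix (Fin n') (Fin n) ℝ) := deterministicChannel '' {f | p f} with hs
  set e : Fin n → Matrix (Fin n') (Fin n) ℝ := fun x => Matrix.single (c x) x 1 with he
  have htop : Submodule.span ℝ s ⊔ Submodule.span ℝ (Set.range e) = ⊤ := by
    by_contra hne
    obtain ⟨φ, hφ, hker⟩ := Submodule.exists_le_ker_of_lt_top _ (lt_top_iff_ne_top.2 hne)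
    have hsum (M : Matrix (Fin n') (Fin n) ℝ) :
        φ M = ∑ y, ∑ x, M y x * φ (Matrix.single y x 1) := by
      conv_lhs => rw [Matrix.matrix_eq_sum_single M]
      simp only [map_sum]
      refine sum_congr rfl fun y _ => sum_congr rfl fun x _ => ?_
      rw [← smul_eq_mul, ← map_smul, Matrix.smul_single, smul_eq_mul, mul_one]
    refine hφ (LinearMap.ext fun M => ?_)
    have hzero := h (fun y x => φ (Matrix.single y x 1)) (fun f hf => ?_) fun x => ?_
    · simp [hsum M, hzero]
    · have := hker (Submodule.mem_sup_left (Submodule.subset_span ⟨f, hf, rfl⟩))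
      rw [LinearMap.mem_ker, hsum, sum_comm] at this
      simpa [deterministicChannel] using this
    · exact hker (Submodule.mem_sup_right (Submodule.subset_span ⟨x, rfl⟩))
  have hrank : n * (n' - 1) ≤ Module.finrank ℝ (Submodule.span ℝ s) := by
    have h1 := Submodule.finrank_add_le_finrank_add_finrank (Submodule.span ℝ s)
      (Submodule.span ℝ (Set.range e))
    have h2 : Module.finrank ℝ (Submodule.span ℝ (Set.range e)) ≤ n := by
      simpa [Set.finrank] using finrank_range_le_card (R := ℝ) e
    rw [htop, finrank_top, Module.finrank_matrix] at h1
    simp only [Module.finrank_self, Fintype.card_fin, mul_one] at h1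
    rw [Nat.mul_sub_one, mul_comm n n']
    omega
  obtain ⟨g, hg, -, hgi⟩ := Submodule.exists_fun_fin_finrank_span_eq ℝ s
  choose f hf using hg
  refine ⟨fun i => f (Fin.castLE hrank i), ?_, fun i => (hf _).1⟩
  simp only [(hf _).2]
  exact (hgi.comp _ (Fin.castLE_injective hrank)).affineIndependent

end Channel

theorem sum_antiGuessingMatrix {n' ε : ℕ} (f : Fin n' → Fin n') :
    ∑ x, antiGuessingMatrix n' ε (f x) x =
      antiGuessingScore ({x : Fin n' | (x : ℕ) < ε} : Finset (Fin n')) f := by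
  rw [antiGuessingScore, card_filter, Nat.cast_sum]
  refine sum_congr rfl fun x _ => ?_
  simp only [antiGuessingMatrix, Matrix.of_apply, mem_filter, mem_univ, true_and]
  by_cases h : f x = x
  · by_cases hx : (x : ℕ) < ε
    · simp [h, hx]
    · simp [h, hx, not_lt.1 hx]
  · by_cases hx : (x : ℕ) < ε <;> by_cases hfx : (f x : ℕ) < ε <;> simp [h, hx, hfx]

/-- Anti-guessing facets: for `n' = ε + m'`, `n' - 2 ≥ d ≥ 2` and
`n' - d + 1 ≥ ε ≥ 3`, every `P ∈ C_d^{n' → n'}` satisfies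
`⟨G_A^{ε,m'}, P⟩ ≤ ε + d - 2`, and `(G_A^{ε,m'}, ε + d - 2)` is a tight Bell
inequality of `C_d^{n' → n'}`. -/
theorem antiGuessingFacet (n' d ε m' : ℕ) (hsum : n' = ε + m')
    (hd : 2 ≤ d) (hdn' : d + 2 ≤ n') (hε3 : 3 ≤ ε) (hεd : ε + d ≤ n' + 1) :
    (∀ P ∈ signalingPolytope n' n' d,
      bip (antiGuessingMatrix n' ε) P ≤ (ε : ℝ) + (d : ℝ) - 2) ∧
    IsTightBell n' n' d (antiGuessingMatrix n' ε) ((ε : ℝ) + (d : ℝ) - 2) := by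
  set L : Finset (Fin n') := {x : Fin n' | (x : ℕ) < ε} with hLdef
  have hLcard : #L = ε := by
    rw [hLdef, Fin.card_filter_val_lt]
    omega
  have hγ {f : Fin n' → Fin n'} (hf : IsSaturating L d f) :
      bip (antiGuessingMatrix n' ε) (deterministicChannel f) = (ε : ℝ) + d - 2 := by
    have : (antiGuessingScore L f : ℝ) + 2 = #L + d := mod_cast hf.2
    rw [bip_deterministicChannel, sum_antiGuessingMatrix, ← hLdef, eq_sub_iff_add_eq, this, hLcard]
  have hbound : ∀ P ∈ signalingPolytope n' n' d,
      bip (antiGuessingMatrix n' ε) P ≤ (ε : ℝ) + (d : ℝ) - 2 := by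
    refine fun P hP => bip_le_of_forall_isVertex (fun V hV => ?_) hP
    obtain ⟨f, hf, rfl⟩ := hV.exists_eq_deterministicChannel
    have : (antiGuessingScore L f : ℝ) + 2 ≤ #L + d :=
      mod_cast antiGuessingScore_add_two_le (by omega) hf
    rw [bip_deterministicChannel, sum_antiGuessingMatrix, ← hLdef, le_sub_iff_add_le]
    rwa [hLcard] at this
  obtain ⟨o, ho⟩ : L.Nonempty := card_pos.1 (by omega)
  obtain ⟨f, hindep, hf⟩ := exists_affineIndependent_deterministicChannel
    (p := IsSaturating L d) (fun x => if x ∈ L then x else o) fun H hH hc =>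
      eq_zero_of_forall_isSaturating (by omega) hd
        (by rw [card_compl, Fintype.card_fin]; omega) ho hH
        (fun x hx => by simpa [hx] using hc x) fun x hx => by simpa [hx] using hc x
  exact ⟨hbound, hbound, _, hindep, fun i => ⟨isVertex_deterministicChannel (hf i).1, hγ (hf i)⟩⟩
end

section
/- Theorem 3 (partial replacer channel bounds): Let d ≥ 1 and D ≥ d be integers, let σ be a D×D density matrix, let 0 ≤ μ ≤ 1, and let R_μ be the partial replacer channel with target σ. Then the signaling dimension of R_μ satisfies ⌈μd + 1 − μ⌉ ≤ κ(R_μ) ≤ min{d, ⌈μd + 1⌉}. -/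
open Finset

open scoped ComplexOrder

/-- A density matrix: positive semidefinite with unit trace. -/
def IsDensity {D : ℕ} (ρ : Matrix (Fin D) (Fin D) ℂ) : Prop :=
  ρ.PosSemidef ∧ ρ.trace = 1

/-- A POVM: positive semidefinite effects summing to the identity. -/
def IsPOVM {D n' : ℕ} (M : Fin n' → Matrix (Fin D) (Fin D) ℂ) : Prop :=
  (∀ y, (M y).PosSemidef) ∧ ∑ y, M y = 1

/-- Embed a `d × d` matrix as the upper-left block of a `D × D` matrix. -/
def embedBlock (d D : ℕ) (X : Matrix (Fin d) (Fin d) ℂ) :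
    Matrix (Fin D) (Fin D) ℂ :=
  Matrix.of fun i j =>
    if h : (i : ℕ) < d ∧ (j : ℕ) < d then X ⟨i, h.1⟩ ⟨j, h.2⟩ else 0

/-- The `d`-dimensional partial replacer channel with replacement state `σ`:
`R_μ(X) = μ·ι(X) + (1-μ)·Tr[X]·σ`. -/
noncomputable def replacer (d D : ℕ) (μ : ℝ) (σ : Matrix (Fin D) (Fin D) ℂ)
    (X : Matrix (Fin d) (Fin d) ℂ) : Matrix (Fin D) (Fin D) ℂ :=
  (μ : ℂ) • embedBlock d D X + ((1 - μ : ℝ) : ℂ) • (X.trace • σ)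

/-- The classical channel induced by states `ρ`, the partial replacer channel,
and POVM `M`: `P(y|x) = Tr[M_y R_μ(ρ_x)]`. -/
noncomputable def inducedChannel (d D n n' : ℕ) (μ : ℝ)
    (σ : Matrix (Fin D) (Fin D) ℂ) (ρ : Fin n → Matrix (Fin d) (Fin d) ℂ)
    (M : Fin n' → Matrix (Fin D) (Fin D) ℂ) : Matrix (Fin n') (Fin n) ℝ :=
  Matrix.of fun y x => ((M y * replacer d D μ σ (ρ x)).trace).re

/-- The partial replacer channel can be simulated with `d'` classical messages and
shared randomness: every induced classical channel lies in `C_{d'}^{n → n'}`. -/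
noncomputable def SimulableBy (d D : ℕ) (μ : ℝ)
    (σ : Matrix (Fin D) (Fin D) ℂ) (d' : ℕ) : Prop :=
  ∀ (n n' : ℕ), 0 < n → 0 < n' →
    ∀ (ρ : Fin n → Matrix (Fin d) (Fin d) ℂ)
      (M : Fin n' → Matrix (Fin D) (Fin D) ℂ),
      (∀ x, IsDensity (ρ x)) → IsPOVM M →
      inducedChannel d D n n' μ σ ρ M ∈ signalingPolytope n n' d'

open scoped MatrixOrder in
theorem Matrix.PosSemidef.exists_conjTranspose_mul_self {m : Type*} [Fintype m] [DecidableEq m]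
    {A : Matrix m m ℂ} (hA : A.PosSemidef) : ∃ B : Matrix m m ℂ, A = B.conjTranspose * B :=
  CStarAlgebra.nonneg_iff_eq_star_mul_self.mp hA.nonneg

theorem Matrix.PosSemidef.trace_mul_nonneg {m : Type*} [Fintype m] [DecidableEq m]
    {A B : Matrix m m ℂ} (hA : A.PosSemidef) (hB : B.PosSemidef) : 0 ≤ (A * B).trace := by
  obtain ⟨C, rfl⟩ := hB.exists_conjTranspose_mul_self
  rw [← Matrix.mul_assoc, Matrix.trace_mul_comm, ← Matrix.mul_assoc]
  exact (hA.mul_mul_conjTranspose_same C).trace_nonneg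

theorem Matrix.IsHermitian.posSemidef_smul_add_smul_one_iff {m : Type*} [Fintype m] [DecidableEq m]
    {A : Matrix m m ℂ} (hA : A.IsHermitian) (a b : ℝ) :
    ((a : ℂ) • A + (b : ℂ) • (1 : Matrix m m ℂ)).PosSemidef ↔
      ∀ i, 0 ≤ a * hA.eigenvalues i + b := by
  have key : (a : ℂ) • A + (b : ℂ) • (1 : Matrix m m ℂ) =
      Unitary.conjStarAlgAut ℂ _ hA.eigenvectorUnitary
        (Matrix.diagonal fun i => ((a * hA.eigenvalues i + b : ℝ) : ℂ)) := by
    conv_lhs => rw [hA.spectral_theorem, ← map_one (Unitary.conjStarAlgAut ℂ _ hA.eigenvectorUnitary),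
      ← map_smul, ← map_smul, ← map_add]
    congr 1
    ext i j
    by_cases h : i = j <;> simp [h, Matrix.diagonal]
  rw [key, Unitary.conjStarAlgAut_apply, Matrix.IsUnit.posSemidef_star_right_conjugate_iff Unitary.isUnit_coe,
    Matrix.posSemidef_diagonal_iff]
  exact forall_congr' fun i => by norm_cast

/-- For `0 ≤ A ≤ 1`, the determinant is a lower bound on the least eigenvalue. -/
theorem Matrix.PosSemidef.det_re_le_trace_mul {d : ℕ} {A ρ : Matrix (Fin d) (Fin d) ℂ}
    (hA : A.PosSemidef) (hA1 : (1 - A).PosSemidef) (hρ : IsDensity ρ) :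
    A.det.re ≤ (A * ρ).trace.re := by
  have h0 := hA.eigenvalues_nonneg
  have h1 : ∀ i, hA.1.eigenvalues i ≤ 1 := by
    have := (hA.1.posSemidef_smul_add_smul_one_iff (-1) 1).1 (by
      convert hA1 using 1; simp [sub_eq_neg_add])
    intro i; linarith [this i]
  have hdet : A.det.re = ∏ i, hA.1.eigenvalues i := by
    rw [hA.1.det_eq_prod_eigenvalues]
    norm_cast
  have hle : ∀ i, A.det.re ≤ hA.1.eigenvalues i := by
    intro i
    rw [hdet, ← Finset.mul_prod_erase _ _ (Finset.mem_univ i)]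
    exact mul_le_of_le_one_right (h0 i) (Finset.prod_le_one (fun j _ => h0 j) fun j _ => h1 j)
  have hpsd := (hA.1.posSemidef_smul_add_smul_one_iff 1 (-A.det.re)).2
    fun i => by linarith [hle i]
  have := (Complex.le_def.1 (hpsd.trace_mul_nonneg hρ.1)).1
  rw [Matrix.add_mul, Matrix.trace_add, Matrix.smul_mul, Matrix.smul_mul, Matrix.one_mul,
    Matrix.trace_smul, Matrix.trace_smul, hρ.2] at this
  simp at this
  linarith

/-- The Cauchy-Binet formula for a Gram matrix, summed over all tuples of rows. -/
theorem Matrix.sum_star_det_mul_det_submatrix {ι : Type*} [Fintype ι] {d : ℕ}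
    (W : Matrix ι (Fin d) ℂ) :
    ∑ z : Fin d → ι, star (W.submatrix z id).det * (W.submatrix z id).det =
      (d.factorial : ℂ) * (W.conjTranspose * W).det := by
  classical
  have expand : (W.conjTranspose * W).det =
      ∑ z : Fin d → ι, (∏ i, star (W (z i) i)) * (W.submatrix z id).det := by
    have : (W.conjTranspose * W).det = Matrix.detRowAlternating.toMultilinearMap
        fun i => ∑ k, star (W k i) • W k := by
      change _ = Matrix.det _
      congr 1
      ext i j
      simp [Matrix.mul_apply]
    rw [this, MultilinearMap.map_sum]
    refine Finset.sum_congr rfl fun z _ => ?_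
    rw [MultilinearMap.map_smul_univ]
    rfl
  have perm : ∀ τ : Equiv.Perm (Fin d), (W.conjTranspose * W).det =
      ∑ z : Fin d → ι, (Equiv.Perm.sign τ : ℂ) * (∏ i, star (W (z (τ i)) i)) *
        (W.submatrix z id).det := by
    intro τ
    rw [expand, ← (Equiv.arrowCongr τ.symm (Equiv.refl ι)).sum_comp]
    refine Finset.sum_congr rfl fun z _ => ?_
    have h1 : (W.submatrix (fun i => z (τ i)) id).det =
        (Equiv.Perm.sign τ : ℂ) * (W.submatrix z id).det :=
      Matrix.det_permute τ (W.submatrix z id)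
    change (∏ i, star (W (z (τ i)) i)) * (W.submatrix (fun i => z (τ i)) id).det = _
    rw [h1]
    ring
  have hcard : (d.factorial : ℂ) * (W.conjTranspose * W).det =
      ∑ _τ : Equiv.Perm (Fin d), (W.conjTranspose * W).det := by
    simp [Fintype.card_perm]
  rw [hcard, Finset.sum_congr rfl fun τ _ => perm τ, Finset.sum_comm]
  refine Finset.sum_congr rfl fun z _ => ?_
  rw [← Finset.sum_mul]
  congr 1
  rw [Matrix.det_apply', star_sum]
  refine Finset.sum_congr rfl fun τ _ => ?_
  simp

/-- Summation by parts for signed weights with nonnegative sublevel sums. -/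
theorem sum_mul_nonpos_of_sublevel_sum_nonneg {ι : Type*} [Fintype ι] (w h : ι → ℝ)
    (hw : ∑ i, w i = 0) (H : ∀ t, 0 ≤ ∑ i with h i ≤ t, w i) : ∑ i, w i * h i ≤ 0 := by
  set M : ℝ := ∑ i, |h i|
  have hb : ∀ i, |h i| ≤ M := fun i =>
    Finset.single_le_sum (f := fun i => |h i|) (fun j _ => abs_nonneg _) (Finset.mem_univ i)
  have hint : ∀ i, ∫ t in Set.Ioc (-M - 1) M, (Set.Ici (h i)).indicator (fun _ => (1 : ℝ)) t =
      M - h i := by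
    intro i
    have hi := abs_le.1 (hb i)
    rw [MeasureTheory.setIntegral_indicator measurableSet_Ici]
    have : Set.Ioc (-M - 1) M ∩ Set.Ici (h i) = Set.Icc (h i) M := by
      ext t
      simp only [Set.mem_inter_iff, Set.mem_Ioc, Set.mem_Ici, Set.mem_Icc]
      constructor
      · rintro ⟨⟨_, h2⟩, h3⟩
        exact ⟨h3, h2⟩
      · rintro ⟨h1, h2⟩
        exact ⟨⟨by linarith, h2⟩, h1⟩
    rw [this]
    simp [hi.2]
  have hpos : 0 ≤ ∫ t in Set.Ioc (-M - 1) M,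
      ∑ i, w i * (Set.Ici (h i)).indicator (fun _ => (1 : ℝ)) t := by
    refine MeasureTheory.integral_nonneg fun t => ?_
    refine (H t).trans_eq ?_
    rw [Finset.sum_filter]
    exact Finset.sum_congr rfl fun i _ => by simp [Set.indicator_apply]
  rw [MeasureTheory.integral_finsetSum] at hpos
  · simp_rw [MeasureTheory.integral_const_mul, hint, mul_sub, Finset.sum_sub_distrib,
      ← Finset.sum_mul, hw] at hpos
    linarith
  · intro i _
    refine MeasureTheory.Integrable.const_mul ?_ _
    exact (MeasureTheory.integrable_const 1).indicator measurableSet_Ici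

/-- A transport theorem in the style of Hall and Strassen: a probability vector `q` that dominates
the containment weights of a random tuple `T` splits as an average of distributions supported on
the entries of the tuples. -/
theorem exists_stdSimplex_of_sum_containment_le {Y Z κ : Type*} [Fintype Y] [DecidableEq Y]
    [Fintype Z] [Fintype κ] [DecidableEq κ] [Nonempty κ] (p : Z → ℝ)
    (T : Z → κ → Y) (q : Y → ℝ) (hpq : ∑ z, p z = ∑ y, q y)
    (H : ∀ S : Finset Y, ∑ z with (∀ i, T z i ∈ S), p z ≤ ∑ y ∈ S, q y) :
    ∃ c : Z → κ → ℝ, (∀ z, c z ∈ stdSimplex ℝ κ) ∧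
      ∀ y, q y = ∑ z, p z * ∑ i with T z i = y, c z i := by
  let L : (Z → κ → ℝ) →ₗ[ℝ] (Y → ℝ) :=
    { toFun := fun c y => ∑ z, p z * ∑ i with T z i = y, c z i
      map_add' := fun a b => by
        ext y
        simp [Finset.sum_add_distrib, mul_add]
      map_smul' := fun a b => by
        ext y
        simp only [Pi.smul_apply, smul_eq_mul, Finset.mul_sum, RingHom.id_apply]
        exact Finset.sum_congr rfl fun _ _ => Finset.sum_congr rfl fun _ _ => by ring }
  let K : Set (Z → κ → ℝ) := Set.univ.pi fun _ => stdSimplex ℝ κ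
  have hKcompact : IsCompact K := isCompact_univ_pi fun _ => isCompact_stdSimplex ℝ κ
  have hKconvex : Convex ℝ K := convex_pi fun _ _ => convex_stdSimplex ℝ κ
  have hLc : Continuous L := L.continuous_of_finiteDimensional
  by_contra hcon
  have hq : q ∉ L '' K := by
    rintro ⟨c, hc, hcq⟩
    exact hcon ⟨c, fun z => hc z (Set.mem_univ z), fun y => (congrFun hcq y).symm⟩
  obtain ⟨f, u, hf, hu⟩ := geometric_hahn_banach_closed_point (hKconvex.linear_image L)
    (hKcompact.image hLc).isClosed hq
  set g : Y → ℝ := fun y => f (Pi.single y 1) with hg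
  have hfg : ∀ v : Y → ℝ, f v = ∑ y, v y * g y := by
    intro v
    conv_lhs => rw [pi_eq_sum_univ' v, map_sum]
    simp [hg]
  choose m hm using fun z => Finite.exists_max fun i => g (T z i)
  have h1 := hf (L fun z => Pi.single (m z) 1)
    ⟨_, fun z _ => single_mem_stdSimplex ℝ (m z), rfl⟩
  have h2 : f (L fun z => Pi.single (m z) 1) = ∑ z, p z * g (T z (m z)) := by
    rw [hfg]
    simp only [L, LinearMap.coe_mk, AddHom.coe_mk, Finset.sum_mul]
    rw [Finset.sum_comm]
    refine Finset.sum_congr rfl fun z _ => ?_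
    rw [Finset.sum_eq_single (T z (m z))]
    · congr 1
      simp [Pi.single_apply]
    · intro y _ hy
      simp [Pi.single_apply, hy.symm]
    · simp
  have h3 := sum_mul_nonpos_of_sublevel_sum_nonneg (Sum.elim q fun z => -p z)
    (Sum.elim g fun z => g (T z (m z))) (by simp [hpq]) (by
      intro t
      have := H {y | g y ≤ t}
      rw [Finset.sum_filter] at this ⊢
      rw [Finset.sum_filter] at this
      have e : ∀ z, (∀ i, g (T z i) ≤ t) ↔ g (T z (m z)) ≤ t :=
        fun z => ⟨fun h => h _, fun h i => (hm z i).trans h⟩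
      simp only [Finset.mem_filter_univ, e] at this
      simp only [Fintype.sum_sum_type, Sum.elim_inl, Sum.elim_inr]
      refine (sub_nonneg.2 this).trans_eq ?_
      rw [sub_eq_add_neg, ← Finset.sum_neg_distrib]
      congr 1
      exact Finset.sum_congr rfl fun z _ => by
        by_cases h : g (T z (m z)) ≤ t
        · rw [if_pos h]
          exact (if_pos h).symm
        · rw [if_neg h, neg_zero]
          exact (if_neg h).symm)
  simp only [Fintype.sum_sum_type, Sum.elim_inl, Sum.elim_inr, neg_mul,
    Finset.sum_neg_distrib] at h3
  rw [hfg] at hu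
  linarith

theorem mem_signalingPolytope_of_support {n n' k : ℕ} {P : Matrix (Fin n') (Fin n) ℝ}
    (hP : IsChannel P) (T : Finset (Fin n')) (hT : T.card ≤ k) (h0 : ∀ y ∉ T, ∀ x, P y x = 0) :
    P ∈ signalingPolytope n n' k := by
  let t : Fin n → Set (Fin n' → ℝ) := fun _ => (fun y => Pi.single y 1) '' (T : Set (Fin n'))
  have hPt : (fun x y => P y x) ∈ convexHull ℝ (Set.univ.pi t) := by
    refine mem_convexHull_pi fun x _ => ?_
    have hcol : (fun y => P y x) = ∑ y ∈ T, P y x • (Pi.single y 1 : Fin n' → ℝ) := by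
      ext y
      by_cases hy : y ∈ T <;> simp [Finset.sum_apply, Pi.single_apply, hy]
      exact h0 y hy x
    rw [hcol]
    refine (convex_convexHull ℝ (t x)).sum_mem (fun y _ => hP.1 y x) ?_
      fun y hy => subset_convexHull ℝ _ ⟨y, hy, rfl⟩
    rw [← hP.2 x]
    exact Finset.sum_subset (Finset.subset_univ T) fun y _ hy => h0 y hy x
  let L : (Fin n → Fin n' → ℝ) →ₗ[ℝ] Matrix (Fin n') (Fin n) ℝ :=
    { toFun := fun v => Matrix.of fun y x => v x y
      map_add' := fun _ _ => rfl
      map_smul' := fun _ _ => rfl }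
  have himg : P ∈ L '' convexHull ℝ (Set.univ.pi t) := ⟨_, hPt, rfl⟩
  rw [LinearMap.image_convexHull] at himg
  refine convexHull_mono ?_ himg
  rintro _ ⟨V, hV, rfl⟩
  choose f hfT hf using fun x => hV x (Set.mem_univ x)
  have hval : ∀ y x, L V y x = if y = f x then 1 else 0 := fun y x => by
    change V x y = _
    rw [← hf x]
    exact Pi.single_apply _ _ _
  change IsVertex k (L V)
  refine ⟨⟨fun y x => ?_, fun x => ?_⟩, fun y x => ?_, ?_⟩
  · rw [hval]
    split_ifs <;> simp
  · simp [hval]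
  · rw [hval]
    split_ifs <;> simp
  · refine (Set.ncard_le_ncard ?_ T.finite_toSet).trans ((Set.ncard_coe_finset T).trans_le hT)
    rintro y ⟨x, hx⟩
    rw [hval] at hx
    have : y = f x := by
      by_contra h
      simp [h] at hx
    exact this ▸ hfT x

theorem convex_signalingPolytope (n n' k : ℕ) : Convex ℝ (signalingPolytope n n' k) :=
  convex_convexHull ℝ _

theorem IsVertex.exists_eq_ite {n n' k : ℕ} {V : Matrix (Fin n') (Fin n) ℝ} (hV : IsVertex k V) :
    ∃ f : Fin n → Fin n', ∀ y x, V y x = if y = f x then 1 else 0 := by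
  have hex : ∀ x, ∃ y, V y x = 1 := by
    intro x
    by_contra! h
    have : ∑ y, V y x = 0 := Finset.sum_eq_zero fun y _ => (hV.2.1 y x).resolve_right (h y)
    linarith [hV.1.2 x]
  choose f hf using hex
  refine ⟨f, fun y x => ?_⟩
  split_ifs with h
  · rw [h, hf]
  · have := Finset.add_le_sum (f := fun y => V y x) (fun i _ => hV.1.1 i x)
      (Finset.mem_univ y) (Finset.mem_univ (f x)) h
    rw [hV.1.2 x, hf] at this
    linarith [hV.1.1 y x]

theorem trace_le_of_mem_signalingPolytope {n k : ℕ} {P : Matrix (Fin n) (Fin n) ℝ}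
    (hP : P ∈ signalingPolytope n n k) : P.trace ≤ k := by
  refine convexHull_min (t := {P : Matrix (Fin n) (Fin n) ℝ | P.trace ≤ k}) ?_
    (convex_halfSpace_le (Matrix.traceLinearMap (Fin n) ℝ ℝ).isLinear _) hP
  rintro V ⟨-, hV01, hVcard⟩
  classical
  have h : V.trace ≤ ∑ y, if ∃ x, V y x ≠ 0 then (1 : ℝ) else 0 := by
    refine Finset.sum_le_sum fun y _ => ?_
    rw [Matrix.diag_apply]
    split_ifs with h
    · rcases hV01 y y with h | h <;> simp [h]
    · push Not at h
      rw [h]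
  refine h.trans ?_
  rw [Finset.sum_boole]
  rw [Set.ncard_eq_toFinset_card'] at hVcard
  have : ({y | ∃ x, V y x ≠ 0} : Finset (Fin n)).card ≤ k := by
    convert hVcard using 2
    ext
    simp
  exact_mod_cast this

/-- Mixing a `d`-message vertex with a constant output can be done by sending a uniformly random
cyclic window of `m` of the `d` messages, together with the constant output. -/
theorem IsVertex.mix_const_mem {n n' d m : ℕ} (hd : 0 < d) (hmd : m ≤ d) {μ : ℝ} (hμ : 0 ≤ μ)
    (hm : μ * d ≤ m) {V : Matrix (Fin n') (Fin n) ℝ} (hV : IsVertex d V) (y₀ : Fin n') :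
    μ • V + (1 - μ) • (Matrix.of fun y _ => if y = y₀ then (1 : ℝ) else 0) ∈
      signalingPolytope n n' (m + 1) := by
  classical
  have : NeZero d := ⟨hd.ne'⟩
  have hd' : (0 : ℝ) < d := by exact_mod_cast hd
  obtain ⟨f, hf⟩ := hV.exists_eq_ite
  obtain ⟨e, g, hfg⟩ : ∃ (e : Fin d → Fin n') (g : Fin n → Fin d), ∀ x, f x = e (g x) := by
    set T : Finset (Fin n') := Finset.univ.image f
    have hT : Fintype.card T ≤ Fintype.card (Fin d) := by
      rw [Fintype.card_coe, Fintype.card_fin, ← Set.ncard_coe_finset]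
      refine (Set.ncard_le_ncard ?_ (Set.toFinite _)).trans hV.2.2
      intro y hy
      obtain ⟨x, -, rfl⟩ := Finset.mem_image.1 hy
      exact ⟨x, by simp [hf]⟩
    obtain ⟨i⟩ := Function.Embedding.nonempty_of_card_le hT
    exact ⟨Function.extend i Subtype.val fun _ => y₀,
      fun x => i ⟨f x, Finset.mem_image_of_mem f (Finset.mem_univ x)⟩,
      fun x => (i.injective.extend_apply Subtype.val (fun _ => y₀)
        ⟨f x, Finset.mem_image_of_mem f (Finset.mem_univ x)⟩).symm⟩
  set α : ℝ := μ * d / m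
  have hα0 : 0 ≤ α := by positivity
  have hα1 : α ≤ 1 := div_le_one_of_le₀ hm (Nat.cast_nonneg m)
  have hαm : α * m = μ * d := by
    rcases Nat.eq_zero_or_pos m with rfl | hm0
    · have : 0 ≤ μ * d := by positivity
      simp only [Nat.cast_zero, mul_zero] at hm ⊢
      linarith
    · have : (0 : ℝ) < m := by exact_mod_cast hm0
      simp only [α]
      field_simp
  let win : Fin d → Finset (Fin d) := fun j => {t | ((t - j : Fin d) : ℕ) < m}
  have hcount : ({i : Fin d | (i : ℕ) < m} : Finset (Fin d)).card = m := by
    rw [Fin.card_filter_val_lt]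
    exact min_eq_right hmd
  have hwin : ∀ j, (win j).card = m := fun j => by
    rw [← hcount, ← Finset.card_map (Equiv.subRight j).toEmbedding]
    congr 1
    ext i
    simp [win]
  have hwin' : ∀ t, ∑ j, (if t ∈ win j then (1 : ℝ) else 0) = m := fun t => by
    have : ∑ j, (if t ∈ win j then (1 : ℝ) else 0) =
        ∑ i : Fin d, if (i : ℕ) < m then (1 : ℝ) else 0 := by
      rw [← (Equiv.subLeft t).sum_comp]
      simp [win]
    rw [this, Finset.sum_boole, hcount]
  let A : Fin d → Matrix (Fin n') (Fin n) ℝ := fun j => Matrix.of fun y x =>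
    (if y = y₀ then 1 else 0) + (if g x ∈ win j then 1 else 0) *
      (α * ((if y = f x then 1 else 0) - if y = y₀ then 1 else 0))
  have hA : ∀ j, A j ∈ signalingPolytope n n' (m + 1) := by
    intro j
    refine mem_signalingPolytope_of_support ⟨fun y x => ?_, fun x => ?_⟩
      (insert y₀ ((win j).image e)) ?_ fun y hy x => ?_
    · simp only [A, Matrix.of_apply]
      split_ifs <;> linarith
    · simp [A, Finset.sum_add_distrib, ← Finset.mul_sum]
    · exact (Finset.card_insert_le _ _).trans
        (Nat.succ_le_succ (Finset.card_image_le.trans_eq (hwin j)))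
    · simp only [Finset.mem_insert, Finset.mem_image, not_or, not_exists, not_and] at hy
      simp only [A, Matrix.of_apply, if_neg hy.1]
      by_cases hx : g x ∈ win j
      · have : y ≠ f x := fun h => hy.2 _ hx ((hfg x).symm.trans h.symm)
        simp [this]
      · simp [hx]
  have hsum : μ • V + (1 - μ) • (Matrix.of fun y _ => if y = y₀ then (1 : ℝ) else 0) =
      ∑ j, (d : ℝ)⁻¹ • A j := by
    ext y x
    simp only [Matrix.add_apply, Matrix.smul_apply, Matrix.of_apply, Matrix.sum_apply, smul_eq_mul,
      A, ← Finset.mul_sum, Finset.sum_add_distrib, ← Finset.sum_mul, hwin', hf]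
    simp only [Finset.sum_const, Finset.card_univ, Fintype.card_fin, nsmul_eq_mul]
    field_simp
    linear_combination ((if y = y₀ then 1 else 0) - if y = f x then 1 else 0) * hαm
  rw [hsum]
  refine (convex_signalingPolytope n n' _).sum_mem (fun _ _ => by positivity) ?_ fun j _ => hA j
  simp [hd'.ne']

theorem mix_const_distribution_mem {n n' d k : ℕ} {μ : ℝ}
    (h : ∀ V : Matrix (Fin n') (Fin n) ℝ, IsVertex d V → ∀ y₀,
      μ • V + (1 - μ) • (Matrix.of fun y _ => if y = y₀ then (1 : ℝ) else 0) ∈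
        signalingPolytope n n' k)
    {P : Matrix (Fin n') (Fin n) ℝ} (hP : P ∈ signalingPolytope n n' d) {q : Fin n' → ℝ}
    (hq : q ∈ stdSimplex ℝ (Fin n')) :
    μ • P + (1 - μ) • (Matrix.of fun y _ => q y) ∈ signalingPolytope n n' k := by
  have hconst : ∀ y₀, μ • P + (1 - μ) • (Matrix.of fun y _ => if y = y₀ then (1 : ℝ) else 0) ∈
      signalingPolytope n n' k := by
    intro y₀
    refine convexHull_min (t := (fun V => μ • V +
      (1 - μ) • (Matrix.of fun y _ => if y = y₀ then (1 : ℝ) else 0)) ⁻¹' signalingPolytope n n' k)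
      (fun V hV => h V hV y₀) ?_ hP
    intro V hV W hW a b ha hb hab
    have := convex_signalingPolytope n n' k hV hW ha hb hab
    rw [Set.mem_preimage]
    convert this using 1
    rw [← eq_sub_iff_add_eq] at hab
    subst hab
    module
  have hsum : μ • P + (1 - μ) • (Matrix.of fun y _ => q y) = ∑ y₀, q y₀ • (μ • P +
      (1 - μ) • (Matrix.of fun y _ => if y = y₀ then (1 : ℝ) else 0)) := by
    simp only [smul_add, Finset.sum_add_distrib, ← Finset.sum_smul, hq.2, one_smul]
    congr 1
    ext y x
    simp [Matrix.sum_apply, mul_comm]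
  rw [hsum]
  exact (convex_signalingPolytope n n' k).sum_mem (fun y _ => hq.1 y) hq.2 fun y _ => hconst y

/-- The Frenkel-Weiner theorem: measuring a `d`-dimensional quantum system induces a classical
channel that `d` classical messages and shared randomness can simulate. -/
theorem frenkel_weiner {d n n' : ℕ} (hd : 1 ≤ d) (E : Fin n' → Matrix (Fin d) (Fin d) ℂ)
    (hE : IsPOVM E) (ρ : Fin n → Matrix (Fin d) (Fin d) ℂ) (hρ : ∀ x, IsDensity (ρ x)) :
    (Matrix.of fun y x => ((E y * ρ x).trace).re) ∈ signalingPolytope n n' d := by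
  have : Nonempty (Fin d) := ⟨⟨0, hd⟩⟩
  choose B hB using fun y => (hE.1 y).exists_conjTranspose_mul_self
  let W : Matrix (Fin n' × Fin d) (Fin d) ℂ := Matrix.of fun k j => B k.1 k.2 j
  let p : (Fin d → Fin n' × Fin d) → ℝ := fun z =>
    Complex.normSq (W.submatrix z id).det / d.factorial
  have hp0 : ∀ z, 0 ≤ p z := fun z => div_nonneg (Complex.normSq_nonneg _) (Nat.cast_nonneg _)
  have hpS : ∀ S : Finset (Fin n'), ∑ z with (∀ i, (z i).1 ∈ S), p z =
      (∑ y ∈ S, E y).det.re := by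
    intro S
    let WS : Matrix (Fin n' × Fin d) (Fin d) ℂ :=
      Matrix.of fun k j => if k.1 ∈ S then B k.1 k.2 j else 0
    have hWS : WS.conjTranspose * WS = ∑ y ∈ S, E y := by
      ext i j
      simp only [Matrix.mul_apply, Fintype.sum_prod_type, Matrix.sum_apply, hB,
        Matrix.conjTranspose_apply, WS, Matrix.of_apply]
      rw [← Finset.sum_subset (Finset.subset_univ S) fun y _ hy => by simp [hy]]
      exact Finset.sum_congr rfl fun y hy => by simp [hy]
    have hcb := Matrix.sum_star_det_mul_det_submatrix WS
    rw [hWS] at hcb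
    have hterm : ∀ z : Fin d → Fin n' × Fin d,
        star (WS.submatrix z id).det * (WS.submatrix z id).det =
          ((if ∀ i, (z i).1 ∈ S then Complex.normSq (W.submatrix z id).det else 0 : ℝ) : ℂ) := by
      intro z
      split_ifs with hz
      · have : WS.submatrix z id = W.submatrix z id := by
          ext i j
          simp [WS, W, hz i]
        rw [this, mul_comm]
        exact Complex.mul_conj _
      · push Not at hz
        obtain ⟨i, hi⟩ := hz
        rw [Matrix.det_eq_zero_of_row_eq_zero i fun j => by simp [WS, hi]]
        simp
    have hre := congrArg Complex.re hcb
    rw [Finset.sum_congr rfl fun z _ => hterm z, ← Complex.ofReal_sum, Complex.ofReal_re,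
      ← Complex.ofReal_natCast, Complex.re_ofReal_mul] at hre
    have hfac : (d.factorial : ℝ) ≠ 0 := by exact_mod_cast d.factorial_ne_zero
    rw [← Finset.sum_div, Finset.sum_filter, hre]
    field_simp
  have hp1 : ∑ z, p z = 1 := by
    have := hpS Finset.univ
    rw [hE.2] at this
    simpa using this
  have htr : ∀ (S : Finset (Fin n')) x,
      ((∑ y ∈ S, E y) * ρ x).trace.re = ∑ y ∈ S, (E y * ρ x).trace.re := fun S x => by
    rw [Finset.sum_mul, Matrix.trace_sum, Complex.re_sum]
  have hq1 : ∀ x, ∑ y, (E y * ρ x).trace.re = 1 := fun x => by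
    rw [← htr, hE.2, one_mul, (hρ x).2, Complex.one_re]
  have htransport := fun x => exists_stdSimplex_of_sum_containment_le p
    (fun z i => (z i).1) (fun y => (E y * ρ x).trace.re) (hp1.trans (hq1 x).symm) (fun S => by
      have hcompl : (1 - ∑ y ∈ S, E y).PosSemidef := by
        rw [← hE.2, ← Finset.sum_compl_add_sum S, add_sub_cancel_right]
        exact Matrix.posSemidef_sum _ fun y _ => hE.1 y
      have hle := (Matrix.posSemidef_sum S fun y _ => hE.1 y).det_re_le_trace_mul hcompl (hρ x)
      rw [← hpS, htr] at hle
      convert hle)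
  choose c hc hcq using htransport
  let A : (Fin d → Fin n' × Fin d) → Matrix (Fin n') (Fin n) ℝ := fun z =>
    Matrix.of fun y x => ∑ i with (z i).1 = y, c x z i
  have hA : ∀ z, A z ∈ signalingPolytope n n' d := by
    intro z
    refine mem_signalingPolytope_of_support
      ⟨fun y x => ?_, fun x => ?_⟩
      (Finset.univ.image fun i => (z i).1) (Finset.card_image_le.trans_eq (by simp)) ?_
    · simp only [A, Matrix.of_apply]
      exact Finset.sum_nonneg fun i _ => (hc x z).1 i
    · simp only [A, Matrix.of_apply]
      rw [← (hc x z).2]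
      exact Finset.sum_fiberwise _ _ _
    · intro y hy x
      simp only [A, Matrix.of_apply]
      refine Finset.sum_eq_zero fun i hi => absurd ?_ hy
      exact Finset.mem_image.2 ⟨i, Finset.mem_univ i, (Finset.mem_filter.1 hi).2⟩
  have hsum : (Matrix.of fun y x => ((E y * ρ x).trace).re) = ∑ z, p z • A z := by
    ext y x
    simpa [Matrix.sum_apply, A] using hcq x y
  rw [hsum]
  exact (convex_signalingPolytope n n' d).sum_mem (fun z _ => hp0 z) hp1 fun z _ => hA z

theorem trace_mul_embedBlock {d D : ℕ} (hdD : d ≤ D) (M : Matrix (Fin D) (Fin D) ℂ)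
    (X : Matrix (Fin d) (Fin d) ℂ) :
    (M * embedBlock d D X).trace =
      (M.submatrix (Fin.castLE hdD) (Fin.castLE hdD) * X).trace := by
  have hrange : ∀ i ∉ Set.range (Fin.castLE hdD), ¬ (i : ℕ) < d := fun i hi h =>
    hi ⟨⟨i, h⟩, rfl⟩
  simp only [Matrix.trace, Matrix.diag_apply, Matrix.mul_apply, embedBlock, Matrix.of_apply]
  symm
  refine Fintype.sum_of_injective _ (Fin.castLE_injective hdD) _ _ (fun i hi => ?_) fun i => ?_
  · simp [hrange i hi]
  · refine Fintype.sum_of_injective _ (Fin.castLE_injective hdD) _ _ (fun j hj => ?_) fun j => ?_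
    · simp [hrange j hj]
    · simp

theorem inducedChannel_eq {d D n n' : ℕ} (hdD : d ≤ D) (μ : ℝ) (σ : Matrix (Fin D) (Fin D) ℂ)
    (ρ : Fin n → Matrix (Fin d) (Fin d) ℂ) (M : Fin n' → Matrix (Fin D) (Fin D) ℂ)
    (hρ : ∀ x, IsDensity (ρ x)) :
    inducedChannel d D n n' μ σ ρ M =
      μ • (Matrix.of fun y x =>
        (((M y).submatrix (Fin.castLE hdD) (Fin.castLE hdD) * ρ x).trace).re) +
      (1 - μ) • (Matrix.of fun y _ => ((M y * σ).trace).re) := by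
  ext y x
  simp only [inducedChannel, replacer, Matrix.of_apply, Matrix.add_apply, Matrix.smul_apply,
    (hρ x).2, Matrix.mul_add, Matrix.mul_smul, Matrix.trace_add, Matrix.trace_smul,
    trace_mul_embedBlock hdD, Complex.add_re, smul_eq_mul, one_mul,
    Complex.re_ofReal_mul]

theorem IsPOVM.submatrix_castLE {d D n' : ℕ} (hdD : d ≤ D) {M : Fin n' → Matrix (Fin D) (Fin D) ℂ}
    (hM : IsPOVM M) : IsPOVM fun y => (M y).submatrix (Fin.castLE hdD) (Fin.castLE hdD) := by
  refine ⟨fun y => (hM.1 y).submatrix _, ?_⟩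
  rw [← Matrix.submatrix_one (Fin.castLE hdD) (Fin.castLE_injective hdD), ← hM.2]
  ext i j
  simp [Matrix.sum_apply]

theorem IsPOVM.trace_mul_mem_stdSimplex {D n' : ℕ} {M : Fin n' → Matrix (Fin D) (Fin D) ℂ}
    (hM : IsPOVM M) {σ : Matrix (Fin D) (Fin D) ℂ} (hσ : IsDensity σ) :
    (fun y => ((M y * σ).trace).re) ∈ stdSimplex ℝ (Fin n') := by
  refine ⟨fun y => (Complex.le_def.1 ((hM.1 y).trace_mul_nonneg hσ.1)).1, ?_⟩
  rw [← Complex.re_sum, ← Matrix.trace_sum, ← Finset.sum_mul, hM.2, one_mul, hσ.2, Complex.one_re]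

theorem le_of_simulableBy {d D : ℕ} (hd : 1 ≤ d) (hdD : d ≤ D) {σ : Matrix (Fin D) (Fin D) ℂ}
    (hσ : IsDensity σ) {μ : ℝ} {k : ℕ} (h : SimulableBy d D μ σ k) : μ * d + 1 - μ ≤ k := by
  classical
  let r : Fin D → Fin d := fun i => if h : (i : ℕ) < d then ⟨i, h⟩ else ⟨0, hd⟩
  let M : Fin d → Matrix (Fin D) (Fin D) ℂ := fun y =>
    Matrix.diagonal fun i => if r i = y then 1 else 0
  let ρ : Fin d → Matrix (Fin d) (Fin d) ℂ := fun x => Matrix.diagonal (Pi.single x 1)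
  have hρ : ∀ x, IsDensity (ρ x) := fun x =>
    ⟨Matrix.PosSemidef.diagonal (Pi.single_nonneg.2 zero_le_one), by simp [ρ, Matrix.trace_diagonal]⟩
  have hM : IsPOVM M := by
    refine ⟨fun y => Matrix.PosSemidef.diagonal fun i => ?_, ?_⟩
    · dsimp only [Pi.zero_apply]
      split_ifs <;> simp
    · ext i j
      by_cases hij : i = j <;> simp [M, Matrix.sum_apply, Matrix.one_apply, hij]
  have htrace := trace_le_of_mem_signalingPolytope (h d d hd hd ρ M hρ hM)
  rw [inducedChannel_eq hdD μ σ ρ M hρ, Matrix.trace_add, Matrix.trace_smul,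
    Matrix.trace_smul] at htrace
  have hσ1 : (Matrix.of fun y (_ : Fin d) => ((M y * σ).trace).re).trace = 1 :=
    (hM.trace_mul_mem_stdSimplex hσ).2
  have hid : (Matrix.of fun y x => (((M y).submatrix (Fin.castLE hdD) (Fin.castLE hdD) *
      ρ x).trace).re).trace = d := by
    have : ∀ y, (((M y).submatrix (Fin.castLE hdD) (Fin.castLE hdD) * ρ y).trace).re = 1 := by
      intro y
      have hr : ∀ i : Fin d, r (Fin.castLE hdD i) = i := fun i => by simp [r]
      simp [M, ρ, Matrix.submatrix_diagonal _ _ (Fin.castLE_injective hdD), Matrix.trace_diagonal,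
        hr, Pi.single_apply]
    rw [Matrix.trace]
    simp only [Matrix.diag_apply, Matrix.of_apply, this]
    simp
  rw [hσ1, hid, smul_eq_mul, smul_eq_mul] at htrace
  linarith

/-- Theorem 3 (partial replacer channel bounds): the signaling dimension `κ(R_μ)`
(the least `d'` such that `R_μ` is simulable with `d'` classical messages)
satisfies `⌈μd + 1 - μ⌉ ≤ κ(R_μ) ≤ min{d, ⌈μd + 1⌉}`. -/
theorem replacer_signaling_dimension_bounds (d D : ℕ) (hd : 1 ≤ d) (hdD : d ≤ D)
    (σ : Matrix (Fin D) (Fin D) ℂ) (hσ : IsDensity σ)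
    (μ : ℝ) (hμ0 : 0 ≤ μ) (hμ1 : μ ≤ 1) :
    (∀ d', SimulableBy d D μ σ d' → Nat.ceil (μ * (d : ℝ) + 1 - μ) ≤ d') ∧
    SimulableBy d D μ σ (min d (Nat.ceil (μ * (d : ℝ) + 1))) := by
  refine ⟨fun k hk => Nat.ceil_le.2 (le_of_simulableBy hd hdD hσ hk), ?_⟩
  intro n n' _ _ ρ M hρ hM
  rw [inducedChannel_eq hdD μ σ ρ M hρ]
  refine mix_const_distribution_mem (d := d) (fun V hV y₀ => ?_)
    (frenkel_weiner hd _ (hM.submatrix_castLE hdD) ρ hρ) (hM.trace_mul_mem_stdSimplex hσ)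
  rcases min_choice d (Nat.ceil (μ * (d : ℝ) + 1)) with hmin | hmin <;> rw [hmin]
  · refine (convex_signalingPolytope n n' d) (subset_convexHull ℝ _ hV) ?_ hμ0
      (sub_nonneg.2 hμ1) (by ring)
    refine mem_signalingPolytope_of_support ⟨fun y x => ?_, fun x => ?_⟩ {y₀} (by simpa using hd)
      fun y hy x => ?_
    · rw [Matrix.of_apply]
      split_ifs <;> simp
    · simp
    · simp [Finset.notMem_singleton.1 hy]
  · rw [Nat.ceil_add_one (by positivity)]
    refine hV.mix_const_mem hd (Nat.ceil_le.2 ?_) hμ0 (Nat.le_ceil _) y₀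
    exact mul_le_of_le_one_left (Nat.cast_nonneg d) hμ1
end
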